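/- arXiv:2409.00239 — 5 statements merged into one kernel-verified Lean document; each statement's English description precedes it below -/
import Mathlib

section
/- Let r ≥ 2, let A and B be disjoint finite sets, let each v ∈ A be equipped with an r-uniform hypergraph G_v on vertex set B with hyperedge set E_v, and fix a partition of B into r+1 parts B_1, …, B_{r+1}. Let G be the (r+1)-uniform hypergraph on vertex set A ∪ B whose hyperedge set is E_1 ∪ E_2, where E_1 = { {v} ∪ e : v ∈ A, e ∈ E_v } and E_2 is the set of all (r+1)-element subsets of B containing exactly one vertex from each part. Then G contains an (r+1)-simplex if and only if there exist v ∈ A and an (r+1)-element set S ⊆ B such that every r-element subset of S is a hyperedge of G_v and the r+1 vertices of S lie in pairwise distinct parts of the partition. -/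
/-- **Rank-increase reduction for simplex finding.**
Let `r ≥ 2`, let `A` and `B` be disjoint finite sets (of vertices of a common
ambient type `V`), let each `v ∈ A` carry an `r`-uniform hypergraph on `B` with
hyperedge set `E v` (each hyperedge is an `r`-element subset of `B`), and fix a
partition of the vertices into `r + 1` parts, encoded by `part : V → Fin (r+1)`.
Form the `(r+1)`-uniform hypergraph `G` on `A ∪ B` whose hyperedges are
`E₁ ∪ E₂`, where `E₁ = { {v} ∪ e : v ∈ A, e ∈ E v }` and `E₂` is the set of all
`(r+1)`-element subsets of `B` containing exactly one vertex from each part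
(i.e. on which `part` is injective).  Then `G` contains an `(r+1)`-simplex
(a set of `r + 2` vertices of `A ∪ B` all of whose `(r+1)`-element subsets are
hyperedges) if and only if there are `v ∈ A` and an `(r+1)`-element subset
`S ⊆ B` such that every `r`-element subset of `S` is a hyperedge of `E v` and
the vertices of `S` lie in pairwise distinct parts. -/
theorem rank_increase_simplex_iff
    (r : ℕ) (hr : 2 ≤ r) (V : Type*) [Fintype V] [DecidableEq V]
    (A B : Finset V) (hAB : Disjoint A B)
    (E : V → Finset (Finset V))
    (hE : ∀ v ∈ A, ∀ e ∈ E v, e ⊆ B ∧ e.card = r)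
    (part : V → Fin (r + 1)) :
    (∃ S : Finset V, S ⊆ A ∪ B ∧ S.card = r + 2 ∧
        ∀ T ⊆ S, T.card = r + 1 →
          ((∃ v ∈ A, ∃ e ∈ E v, T = insert v e) ∨
            (T ⊆ B ∧ T.card = r + 1 ∧ Set.InjOn part (T : Set V)))) ↔
      (∃ v ∈ A, ∃ S : Finset V, S ⊆ B ∧ S.card = r + 1 ∧
        (∀ T ⊆ S, T.card = r → T ∈ E v) ∧ Set.InjOn part (S : Set V)) := by
  have hdisj : ∀ x ∈ A, x ∉ B := fun x hA hB => Finset.disjoint_left.1 hAB hA hB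
  constructor
  · rintro ⟨S, hSAB, hScard, hS⟩
    have pair_subset : ∀ x ∈ S, ∀ y ∈ S, ∃ T ⊆ S, T.card = r + 1 ∧ x ∈ T ∧ y ∈ T := by
      intro x hx y hy
      obtain ⟨T, hT, hTS, hTcard⟩ := Finset.exists_subsuperset_card_eq
        (s := {x, y}) (t := S) (n := r + 1) (by simp [Finset.insert_subset_iff, hx, hy])
        (Finset.card_le_two.trans (by omega)) (by omega)
      exact ⟨T, hTS, hTcard, hT (by simp), hT (by simp)⟩
    have unique_A : ∀ x ∈ S, ∀ y ∈ S, x ∈ A → y ∈ A → x = y := by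
      intro x hx y hy hxA hyA
      obtain ⟨T, hTS, hTcard, hxT, hyT⟩ := pair_subset x hx y hy
      rcases hS T hTS hTcard with ⟨v, hv, e, he, rfl⟩ | ⟨hTB, -, -⟩
      · have eq_v : ∀ z ∈ insert v e, z ∈ A → z = v := fun z hz hzA =>
          (Finset.mem_insert.1 hz).resolve_right
            fun hze => hdisj z hzA ((hE v hv e he).1 hze)
        rw [eq_v x hxT hxA, eq_v y hyT hyA]
      · exact absurd (hTB hxT) (hdisj x hxA)
    obtain ⟨v, hvS, hvA⟩ : ∃ v ∈ S, v ∈ A := by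
      by_contra! hSA
      obtain ⟨x, hx, y, hy, hxy, hpart⟩ := Finset.exists_ne_map_eq_of_card_lt_of_maps_to
        (s := S) (t := Finset.univ) (f := part) (by simp [hScard]) (by simp)
      obtain ⟨T, hTS, hTcard, hxT, hyT⟩ := pair_subset x hx y hy
      rcases hS T hTS hTcard with ⟨v, hv, e, he, rfl⟩ | ⟨-, -, hinj⟩
      · exact hSA v (hTS (Finset.mem_insert_self v e)) hv
      · exact hxy (hinj hxT hyT hpart)
    have hB : S.erase v ⊆ B := by
      intro x hx
      obtain ⟨hxv, hxS⟩ := Finset.mem_erase.1 hx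
      exact (Finset.mem_union.1 (hSAB hxS)).resolve_left
        fun hxA => hxv (unique_A x hxS v hvS hxA hvA)
    have hcard : (S.erase v).card = r + 1 := by
      rw [Finset.card_erase_of_mem hvS, hScard]; rfl
    refine ⟨v, hvA, S.erase v, hB, hcard, fun T hT hTcard => ?_, ?_⟩
    · have hvT : v ∉ T := fun h => Finset.notMem_erase v S (hT h)
      have hTS : insert v T ⊆ S :=
        Finset.insert_subset hvS (hT.trans (Finset.erase_subset v S))
      rcases hS _ hTS (by rw [Finset.card_insert_of_notMem hvT, hTcard]) with
        ⟨w, hw, e, he, heq⟩ | ⟨hTB, -, -⟩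
      · obtain rfl : w = v :=
          unique_A w (hTS (heq ▸ Finset.mem_insert_self w e)) v hvS hw hvA
        have hwe : w ∉ e := fun h => hdisj w hw ((hE w hw e he).1 h)
        have hTe : T = e := by
          rw [← Finset.erase_insert hvT, heq, Finset.erase_insert hwe]
        rwa [hTe]
      · exact absurd (hTB (Finset.mem_insert_self v T)) (hdisj v hvA)
    · rcases hS _ (Finset.erase_subset v S) hcard with ⟨w, hw, e, he, heq⟩ | ⟨-, -, hinj⟩
      · exact absurd (hB (heq ▸ Finset.mem_insert_self w e)) (hdisj w hw)
      · exact hinj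
  · rintro ⟨v, hvA, S, hSB, hScard, hS, hinj⟩
    have hvS : v ∉ S := fun h => hdisj v hvA (hSB h)
    refine ⟨insert v S, ?_, by rw [Finset.card_insert_of_notMem hvS, hScard], ?_⟩
    · exact Finset.insert_subset (Finset.mem_union_left B hvA)
        (hSB.trans Finset.subset_union_right)
    · intro T hT hTcard
      by_cases hvT : v ∈ T
      · refine Or.inl ⟨v, hvA, T.erase v, hS _ (Finset.subset_insert_iff.1 hT) ?_,
          (Finset.insert_erase hvT).symm⟩
        rw [Finset.card_erase_of_mem hvT, hTcard]; rfl
      · have hTS : T ⊆ S := (Finset.subset_insert_iff_of_notMem hvT).1 hT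
        exact Or.inr ⟨hTS.trans hSB, hTcard, hinj.mono hTS⟩
end

section
/- Let V be an n-element set, let M ⊆ V with |M| = m, let 0 ≤ r ≤ n, and let S be a uniformly random r-element subset of V. Set μ = r·m/n (a real number). Then for every real δ with 0 < δ ≤ 1, the probability that |S ∩ M| ≥ (1+δ)μ is at most exp(−μδ²/3). -/
open Classical

/-- The number of `r`-sets containing a fixed `t`-set is at most `(r / n) ^ t` times the number
of all `r`-sets. -/
theorem choose_sub_sub_le_choose_mul_pow (t n r : ℕ) (htr : t ≤ r) (hrn : r ≤ n) :
    ((n - t).choose (r - t) : ℝ) ≤ n.choose r * ((r : ℝ) / n) ^ t := by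
  induction t generalizing n r with
  | zero => simp
  | succ t ih =>
    obtain ⟨r, rfl⟩ : ∃ k, r = k + 1 := ⟨r - 1, by omega⟩
    obtain ⟨n, rfl⟩ : ∃ k, n = k + 1 := ⟨n - 1, by omega⟩
    have hrn' : r ≤ n := by omega
    have hcast : (r : ℝ) ≤ n := by exact_mod_cast hrn'
    have hratio : (r : ℝ) / n ≤ ((r + 1 : ℕ) : ℝ) / ((n + 1 : ℕ) : ℝ) := by
      rcases Nat.eq_zero_or_pos n with rfl | hn
      · simp only [Nat.cast_zero, div_zero]
        positivity
      · rw [div_le_div_iff₀ (by exact_mod_cast hn) (by positivity)]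
        push_cast
        nlinarith
    have hchoose : ((n + 1).choose (r + 1) : ℝ) * (((r + 1 : ℕ) : ℝ) / ((n + 1 : ℕ) : ℝ))
        = n.choose r := by
      have h : ((n + 1 : ℕ) : ℝ) * n.choose r = (n + 1).choose (r + 1) * ((r + 1 : ℕ) : ℝ) := by
        exact_mod_cast Nat.add_one_mul_choose_eq n r
      rw [← mul_div_assoc, ← h, mul_div_cancel_left₀ _ (by positivity)]
    rw [Nat.add_sub_add_right, Nat.add_sub_add_right, pow_succ', ← mul_assoc, hchoose]
    refine (ih n r (by omega) hrn').trans ?_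
    gcongr

theorem card_filter_superset_powersetCard_le {V : Type*} [Fintype V] [DecidableEq V] (r : ℕ)
    (hr : r ≤ Fintype.card V) (T : Finset V) :
    (((Finset.powersetCard r (Finset.univ : Finset V)).filter (fun S => T ⊆ S)).card : ℝ) ≤
      (Fintype.card V).choose r * ((r : ℝ) / Fintype.card V) ^ T.card := by
  by_cases hT : T.card ≤ r
  · refine le_trans ?_ (choose_sub_sub_le_choose_mul_pow T.card _ r hT hr)
    rw [← Finset.card_compl, ← Finset.card_powersetCard]
    refine Nat.cast_le.mpr (Finset.card_le_card_of_injOn (fun S => S \ T) ?_ ?_)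
    · intro S hS
      simp only [Finset.coe_filter, Finset.mem_powersetCard, Set.mem_ofPred_eq] at hS
      simp only [Finset.mem_coe, Finset.mem_powersetCard]
      refine ⟨fun x hx => ?_, ?_⟩
      · simpa using (Finset.mem_sdiff.mp hx).2
      · rw [Finset.card_sdiff_of_subset hS.2, hS.1.2]
    · intro S hS S' hS' h
      simp only [Finset.coe_filter, Set.mem_ofPred_eq] at hS hS'
      have h' : S \ T = S' \ T := h
      rw [← Finset.sdiff_union_of_subset hS.2, h', Finset.sdiff_union_of_subset hS'.2]
  · rw [Finset.filter_eq_empty_iff.mpr]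
    · simp only [Finset.card_empty, Nat.cast_zero]
      positivity
    · intro S hS hTS
      exact hT ((Finset.card_le_card hTS).trans (Finset.mem_powersetCard.mp hS).2.le)

/-- The probability generating function of a hypergeometric variable at `1 + x`, for `0 ≤ x`,
is at most that of a binomial variable with the same mean. -/
theorem sum_powersetCard_one_add_pow_card_inter_le {V : Type*} [Fintype V] [DecidableEq V]
    (r : ℕ) (hr : r ≤ Fintype.card V) (M : Finset V) {x : ℝ} (hx : 0 ≤ x) :
    ∑ S ∈ Finset.powersetCard r (Finset.univ : Finset V), (1 + x) ^ (S ∩ M).card ≤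
      (Fintype.card V).choose r * (1 + x * ((r : ℝ) / Fintype.card V)) ^ M.card := by
  have expand (A : Finset V) (y : ℝ) : (1 + y) ^ A.card = ∑ T ∈ A.powerset, y ^ T.card := by
    rw [add_comm, ← Finset.sum_pow_mul_eq_add_pow]
    simp
  calc ∑ S ∈ Finset.powersetCard r (Finset.univ : Finset V), (1 + x) ^ (S ∩ M).card
      = ∑ S ∈ Finset.powersetCard r (Finset.univ : Finset V),
          ∑ T ∈ M.powerset, if T ⊆ S then x ^ T.card else 0 := by
        refine Finset.sum_congr rfl fun S _ => ?_
        rw [expand, ← Finset.sum_filter]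
        refine Finset.sum_congr ?_ fun _ _ => rfl
        ext T
        rw [Finset.mem_powerset, Finset.subset_inter_iff, Finset.mem_filter, Finset.mem_powerset,
          and_comm]
    _ = ∑ T ∈ M.powerset, (((Finset.powersetCard r (Finset.univ : Finset V)).filter
          (fun S => T ⊆ S)).card : ℝ) * x ^ T.card := by
        rw [Finset.sum_comm]
        refine Finset.sum_congr rfl fun T _ => ?_
        rw [← Finset.sum_filter, Finset.sum_const, nsmul_eq_mul]
    _ ≤ ∑ T ∈ M.powerset, ((Fintype.card V).choose r * ((r : ℝ) / Fintype.card V) ^ T.card)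
          * x ^ T.card := by
        gcongr with T
        exact card_filter_superset_powersetCard_le r hr T
    _ = (Fintype.card V).choose r * (1 + x * ((r : ℝ) / Fintype.card V)) ^ M.card := by
        rw [expand, Finset.mul_sum]
        refine Finset.sum_congr rfl fun T _ => ?_
        rw [mul_pow]
        ring

theorem add_sq_div_three_le_one_add_mul_log {δ : ℝ} (hδ0 : 0 ≤ δ) (hδ1 : δ ≤ 1) :
    δ + δ ^ 2 / 3 ≤ (1 + δ) * Real.log (1 + δ) := by
  have h := Real.le_log_one_add_of_nonneg hδ0
  calc δ + δ ^ 2 / 3 ≤ (1 + δ) * (2 * δ / (δ + 2)) := by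
        rw [← mul_div_assoc, le_div_iff₀ (by positivity)]
        nlinarith [mul_nonneg (sq_nonneg δ) (sub_nonneg.mpr hδ1)]
    _ ≤ _ := by gcongr

/-- **Hypergeometric tail bound (multiplicative Chernoff form).**
Let `V` be an `n`-element set, `M ⊆ V` with `|M| = m`, `0 ≤ r ≤ n`, and let
`S` be a uniformly random `r`-element subset of `V`, so that `|S ∩ M|` is
hypergeometrically distributed with parameters `(n, m, r)` and mean
`μ = r * m / n`.  Then for every real `δ` with `0 < δ ≤ 1`, the probability
that `|S ∩ M| ≥ (1 + δ) μ` — expressed as the number of `r`-element subsets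
with this property divided by `C(n, r)` — is at most `exp (-μ δ² / 3)`. -/
theorem hypergeometric_upper_tail
    (V : Type*) [Fintype V] [DecidableEq V] (n m r : ℕ)
    (hV : Fintype.card V = n) (M : Finset V) (hM : M.card = m) (hrn : r ≤ n)
    (μ : ℝ) (hμ : μ = ((r : ℝ) * (m : ℝ)) / (n : ℝ))
    (δ : ℝ) (hδ0 : 0 < δ) (hδ1 : δ ≤ 1) :
    (((Finset.powersetCard r (Finset.univ : Finset V)).filter
          (fun S => (1 + δ) * μ ≤ ((S ∩ M).card : ℝ))).card : ℝ) /
        (n.choose r : ℝ)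
      ≤ Real.exp (-(μ * δ ^ 2 / 3)) := by
  subst hV hM
  have hμ0 : 0 ≤ μ := by rw [hμ]; positivity
  have hC : (0 : ℝ) < (Fintype.card V).choose r := by exact_mod_cast Nat.choose_pos hrn
  rw [div_le_iff₀ hC]
  set F := (Finset.powersetCard r (Finset.univ : Finset V)).filter
    (fun S => (1 + δ) * μ ≤ ((S ∩ M).card : ℝ))
  have markov : (F.card : ℝ) * (1 + δ) ^ ((1 + δ) * μ) ≤
      ∑ S ∈ Finset.powersetCard r (Finset.univ : Finset V), (1 + δ) ^ (S ∩ M).card := by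
    rw [← nsmul_eq_mul]
    refine (Finset.card_nsmul_le_sum F (fun S => (1 + δ) ^ (S ∩ M).card) _ fun S hS => ?_).trans
      (Finset.sum_le_sum_of_subset_of_nonneg (Finset.filter_subset _ _)
        fun _ _ _ => by positivity)
    rw [← Real.rpow_natCast]
    exact Real.rpow_le_rpow_of_exponent_le (by linarith) (Finset.mem_filter.mp hS).2
  have pgf : (1 + δ * ((r : ℝ) / Fintype.card V)) ^ M.card ≤ Real.exp (δ * μ) := by
    calc (1 + δ * ((r : ℝ) / Fintype.card V)) ^ M.card
        ≤ Real.exp (δ * ((r : ℝ) / Fintype.card V)) ^ M.card := by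
          gcongr
          rw [add_comm]
          exact Real.add_one_le_exp _
      _ = Real.exp (δ * μ) := by
          rw [← Real.exp_nat_mul, hμ]
          ring_nf
  have hexp : Real.exp (δ * μ) ≤
      Real.exp (-(μ * δ ^ 2 / 3)) * (1 + δ) ^ ((1 + δ) * μ) := by
    rw [Real.rpow_def_of_pos (by linarith), ← Real.exp_add, Real.exp_le_exp]
    have := mul_le_mul_of_nonneg_left (add_sq_div_three_le_one_add_mul_log hδ0.le hδ1) hμ0
    linarith
  refine le_of_mul_le_mul_right ?_ (show (0 : ℝ) < (1 + δ) ^ ((1 + δ) * μ) by positivity)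
  calc (F.card : ℝ) * (1 + δ) ^ ((1 + δ) * μ)
      ≤ (Fintype.card V).choose r * (1 + δ * ((r : ℝ) / Fintype.card V)) ^ M.card :=
        markov.trans (sum_powersetCard_one_add_pow_card_inter_le r hrn M hδ0.le)
    _ ≤ (Fintype.card V).choose r *
          (Real.exp (-(μ * δ ^ 2 / 3)) * (1 + δ) ^ ((1 + δ) * μ)) := by
        gcongr
        exact pgf.trans hexp
    _ = _ := by ring
end

section
/- Let V be an n-element set, let M ⊆ V with |M| = m, let 0 ≤ r ≤ n, and let S be a uniformly random r-element subset of V. Set μ = r·m/n (a real number) and assume μ > 0. Then for every real δ with δ > 2e − 1, the probability that |S ∩ M| > (1+δ)μ is less than 2^{−(1+δ)μ}. -/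
/-- At most `C(|V| - |T|, r - |T|)` of the `r`-element sets contain a given set `T`. -/
theorem Finset.card_powersetCard_filter_superset_le {V : Type*} [Fintype V] [DecidableEq V]
    (r : ℕ) (T : Finset V) :
    ((Finset.powersetCard r (Finset.univ : Finset V)).filter (fun S => T ⊆ S)).card
      ≤ (Fintype.card V - T.card).choose (r - T.card) := by
  rw [← Finset.card_compl, ← Finset.card_powersetCard]
  refine Finset.card_le_card_of_injOn (fun S => S \ T) ?_ ?_
  · intro S hS
    simp only [Finset.coe_filter, Finset.mem_powersetCard, Set.mem_ofPred_eq] at hS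
    simp only [Finset.mem_coe, Finset.mem_powersetCard]
    refine ⟨fun x hx => ?_, ?_⟩
    · simpa using (Finset.mem_sdiff.mp hx).2
    · rw [Finset.card_sdiff_of_subset hS.2, hS.1.2]
  · intro S hS S' hS' h
    simp only [Finset.coe_filter, Set.mem_ofPred_eq] at hS hS'
    rw [← Finset.sdiff_union_of_subset hS.2, ← Finset.sdiff_union_of_subset hS'.2]
    exact congrArg (· ∪ T) h

/-- Union bound for the number of `r`-element sets meeting `M` in at least `k` elements. -/
theorem Finset.card_powersetCard_filter_le_card_inter_le {V : Type*} [Fintype V] [DecidableEq V]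
    (r k : ℕ) (M : Finset V) :
    ((Finset.powersetCard r (Finset.univ : Finset V)).filter
        (fun S => k ≤ (S ∩ M).card)).card
      ≤ M.card.choose k * (Fintype.card V - k).choose (r - k) := by
  calc _ ≤ ((Finset.powersetCard k M).biUnion fun T =>
          (Finset.powersetCard r (Finset.univ : Finset V)).filter (fun S => T ⊆ S)).card := by
        refine Finset.card_le_card fun S hS => ?_
        obtain ⟨hS, hk⟩ := Finset.mem_filter.mp hS
        obtain ⟨T, hT, hTk⟩ := Finset.exists_subset_card_eq hk
        obtain ⟨hTS, hTM⟩ := Finset.subset_inter_iff.mp hT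
        exact Finset.mem_biUnion.mpr ⟨T, Finset.mem_powersetCard.mpr ⟨hTM, hTk⟩,
          Finset.mem_filter.mpr ⟨hS, hTS⟩⟩
    _ ≤ (Finset.powersetCard k M).card * (Fintype.card V - k).choose (r - k) := by
        refine Finset.card_biUnion_le_card_mul _ _ _ fun T hT => ?_
        have h := Finset.card_powersetCard_filter_superset_le r T
        rwa [(Finset.mem_powersetCard.mp hT).2] at h
    _ = _ := by rw [Finset.card_powersetCard]

theorem Nat.descFactorial_mul_pow_le_descFactorial_mul_pow {n r : ℕ} (h : r ≤ n) (k : ℕ) :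
    r.descFactorial k * n ^ k ≤ n.descFactorial k * r ^ k := by
  induction k with
  | zero => simp
  | succ k ih =>
    have hstep : (r - k) * n ≤ (n - k) * r := by
      rw [Nat.sub_mul, Nat.sub_mul, Nat.mul_comm n r]
      exact Nat.sub_le_sub_left (Nat.mul_le_mul_left k h) _
    calc r.descFactorial (k + 1) * n ^ (k + 1)
        = ((r - k) * n) * (r.descFactorial k * n ^ k) := by
          rw [Nat.descFactorial_succ]; ring
      _ ≤ ((n - k) * r) * (n.descFactorial k * r ^ k) := Nat.mul_le_mul hstep ih
      _ = n.descFactorial (k + 1) * r ^ (k + 1) := by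
          rw [Nat.descFactorial_succ]; ring

theorem Nat.choose_sub_mul_pow_le {n r k : ℕ} (hrn : r ≤ n) (hkr : k ≤ r) :
    (n - k).choose (r - k) * n ^ k ≤ n.choose r * r ^ k := by
  have hpos : 0 < n.descFactorial k := Nat.descFactorial_pos.mpr (hkr.trans hrn)
  have hmul : n.choose r * r.descFactorial k = n.descFactorial k * (n - k).choose (r - k) := by
    rw [Nat.descFactorial_eq_factorial_mul_choose, Nat.descFactorial_eq_factorial_mul_choose,
      mul_left_comm, Nat.choose_mul hkr, mul_assoc]
  refine Nat.le_of_mul_le_mul_left ?_ hpos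
  calc n.descFactorial k * ((n - k).choose (r - k) * n ^ k)
      = n.choose r * (r.descFactorial k * n ^ k) := by rw [← mul_assoc, ← hmul, mul_assoc]
    _ ≤ n.choose r * (n.descFactorial k * r ^ k) :=
        Nat.mul_le_mul_left _ (Nat.descFactorial_mul_pow_le_descFactorial_mul_pow hrn k)
    _ = n.descFactorial k * (n.choose r * r ^ k) := by ring

/-- The probability that a uniformly random `r`-element set meets `M` in at least `k` elements
is at most `μ ^ k / k!`, where `μ = r * |M| / |V|`. -/
theorem hypergeometric_upper_tail_le {V : Type*} [Fintype V] [DecidableEq V] [Nonempty V]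
    {r : ℕ} (hr : r ≤ Fintype.card V) (k : ℕ) (M : Finset V) :
    (((Finset.powersetCard r (Finset.univ : Finset V)).filter
          (fun S => k ≤ (S ∩ M).card)).card : ℝ) / ((Fintype.card V).choose r : ℝ)
      ≤ ((r : ℝ) * (M.card : ℝ) / (Fintype.card V : ℝ)) ^ k / (k.factorial : ℝ) := by
  rcases lt_or_ge r k with hk | hk
  · rw [Finset.filter_eq_empty_iff.mpr]
    · simp only [Finset.card_empty, Nat.cast_zero, zero_div]
      positivity
    · intro S hS hkS
      have := Finset.card_le_card (Finset.inter_subset_left : S ∩ M ⊆ S)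
      have := (Finset.mem_powersetCard.mp hS).2
      omega
  · have hcount := Finset.card_powersetCard_filter_le_card_inter_le r k M
    have hpow := Nat.choose_sub_mul_pow_le hr hk
    have hdesc : M.card.choose k * k.factorial ≤ M.card ^ k := by
      rw [mul_comm, ← Nat.descFactorial_eq_factorial_mul_choose]
      exact Nat.descFactorial_le_pow _ _
    have hn : (0 : ℝ) < Fintype.card V := by exact_mod_cast Fintype.card_pos
    have hc : (0 : ℝ) < (Fintype.card V).choose r := by exact_mod_cast Nat.choose_pos hr
    rw [div_pow, div_div, div_le_div_iff₀ hc (by positivity)]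
    generalize Fintype.card V = n at *
    norm_cast
    calc _ ≤ (M.card.choose k * (n - k).choose (r - k)) * (n ^ k * k.factorial) :=
          Nat.mul_le_mul_right _ hcount
      _ = (M.card.choose k * k.factorial) * ((n - k).choose (r - k) * n ^ k) := by ring
      _ ≤ M.card ^ k * (n.choose r * r ^ k) := Nat.mul_le_mul hdesc hpow
      _ = (r * M.card) ^ k * n.choose r := by ring

theorem Real.pow_div_factorial_lt_two_rpow_neg {x a : ℝ} {k : ℕ} (hx : 0 ≤ x)
    (hxa : 2 * Real.exp 1 * x ≤ a) (hak : a < k) :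
    x ^ k / (k.factorial : ℝ) < (2 : ℝ) ^ (-a) := by
  have hk : (0 : ℝ) < k := lt_of_le_of_lt (by positivity) (hxa.trans_lt hak)
  have hexp : (k : ℝ) ^ k / (k.factorial : ℝ) ≤ Real.exp 1 ^ k := by
    rw [← Real.exp_nat_mul, mul_one]
    exact Real.pow_div_factorial_le_exp _ hk.le k
  calc x ^ k / (k.factorial : ℝ) = (x / k) ^ k * ((k : ℝ) ^ k / (k.factorial : ℝ)) := by
        rw [div_pow]
        field_simp
    _ ≤ (x / k) ^ k * Real.exp 1 ^ k := by gcongr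
    _ = (Real.exp 1 * x / k) ^ k := by rw [← mul_pow]; ring
    _ ≤ (2⁻¹ : ℝ) ^ k := by
        gcongr
        rw [div_le_iff₀ hk]
        linarith
    _ = (2 : ℝ) ^ (-(k : ℝ)) := by
        rw [Real.rpow_neg zero_le_two, Real.rpow_natCast, inv_pow]
    _ < (2 : ℝ) ^ (-a) := Real.rpow_lt_rpow_of_exponent_lt one_lt_two (by linarith)

/-- **Hypergeometric tail bound for large deviations.**
Let `V` be an `n`-element set, `M ⊆ V` with `|M| = m`, `0 ≤ r ≤ n`, and let
`S` be a uniformly random `r`-element subset of `V`, so that `|S ∩ M|` is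
hypergeometrically distributed with parameters `(n, m, r)` and mean
`μ = r * m / n`; assume `μ > 0`.  Then for every real `δ > 2e - 1`, the
probability that `|S ∩ M| > (1 + δ) μ` — expressed as the number of
`r`-element subsets with this property divided by `C(n, r)` — is less than
`2 ^ (-(1 + δ) μ)`. -/
theorem hypergeometric_far_tail
    (V : Type*) [Fintype V] [DecidableEq V] (n m r : ℕ)
    (hV : Fintype.card V = n) (M : Finset V) (hM : M.card = m) (hrn : r ≤ n)
    (μ : ℝ) (hμ : μ = ((r : ℝ) * (m : ℝ)) / (n : ℝ)) (hμpos : 0 < μ)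
    (δ : ℝ) (hδ : 2 * Real.exp 1 - 1 < δ) :
    (((Finset.powersetCard r (Finset.univ : Finset V)).filter
          (fun S => (1 + δ) * μ < ((S ∩ M).card : ℝ))).card : ℝ) /
        (n.choose r : ℝ)
      < (2 : ℝ) ^ (-((1 + δ) * μ)) := by
  subst hV hM hμ
  have hV : Nonempty V := by
    by_contra h
    rw [not_nonempty_iff] at h
    simp at hμpos
  set μ : ℝ := (r : ℝ) * (M.card : ℝ) / (Fintype.card V : ℝ)
  have hmul : 2 * Real.exp 1 * μ ≤ (1 + δ) * μ :=
    mul_le_mul_of_nonneg_right (by linarith) hμpos.le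
  have hnonneg : 0 ≤ (1 + δ) * μ := le_trans (by positivity) hmul
  refine lt_of_le_of_lt ?_ (Real.pow_div_factorial_lt_two_rpow_neg hμpos.le hmul
    (k := ⌊(1 + δ) * μ⌋₊ + 1) (by exact_mod_cast Nat.lt_floor_add_one _))
  refine le_trans ?_ (hypergeometric_upper_tail_le hrn _ M)
  gcongr with S hS
  intro h
  exact Nat.succ_le_of_lt ((Nat.floor_lt hnonneg).mpr h)
end

section
/- Let ℓ, k, n be natural numbers with ℓ² ≤ k, 2ℓ ≤ k, k ≤ n, and n ≥ 1. Then C(n−ℓ, k−ℓ)/C(n, k) ≥ e^{−2} · (k/n)^ℓ. -/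
/-- For `ℓ² ≤ k` and `2ℓ ≤ k`, the falling factorial is within a factor `e²` of `k ^ ℓ`. -/
theorem exp_neg_two_mul_pow_le_descFactorial {ℓ k : ℕ} (hl2 : ℓ ^ 2 ≤ k) (h2l : 2 * ℓ ≤ k) :
    Real.exp (-2) * (k : ℝ) ^ ℓ ≤ (k.descFactorial ℓ : ℝ) := by
  rcases Nat.eq_zero_or_pos k with rfl | hk
  · obtain rfl : ℓ = 0 := by omega
    simp
  have hd : (0 : ℝ) < (k : ℝ) - ℓ := by
    have : ℓ < k := by omega
    exact sub_pos.mpr (by exact_mod_cast this)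
  have hl2' : (ℓ : ℝ) ^ 2 ≤ k := by exact_mod_cast hl2
  have h2l' : 2 * (ℓ : ℝ) ≤ k := by exact_mod_cast h2l
  have hbase : (k : ℝ) ≤ ((k : ℝ) - ℓ) * Real.exp (ℓ / ((k : ℝ) - ℓ)) := by
    calc (k : ℝ) = ((k : ℝ) - ℓ) * (ℓ / ((k : ℝ) - ℓ) + 1) := by field_simp; ring
      _ ≤ _ := mul_le_mul_of_nonneg_left (Real.add_one_le_exp _) hd.le
  have hexp : (ℓ : ℝ) * (ℓ / ((k : ℝ) - ℓ)) ≤ 2 := by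
    rw [← mul_div_assoc, div_le_iff₀ hd]
    linarith
  have hdesc : ((k : ℝ) - ℓ) ^ ℓ ≤ (k.descFactorial ℓ : ℝ) := by
    calc ((k : ℝ) - ℓ) ^ ℓ ≤ ((k + 1 - ℓ : ℕ) : ℝ) ^ ℓ := by
          refine pow_le_pow_left₀ hd.le ?_ ℓ
          rw [Nat.cast_sub (by omega)]
          push_cast
          linarith
      _ ≤ _ := by exact_mod_cast Nat.pow_sub_le_descFactorial k ℓ
  calc Real.exp (-2) * (k : ℝ) ^ ℓ
      ≤ Real.exp (-2) * (((k : ℝ) - ℓ) * Real.exp (ℓ / ((k : ℝ) - ℓ))) ^ ℓ := by gcongr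
    _ = ((k : ℝ) - ℓ) ^ ℓ * (Real.exp (-2) * Real.exp (ℓ * (ℓ / ((k : ℝ) - ℓ)))) := by
        rw [mul_pow, Real.exp_nat_mul]; ring
    _ ≤ ((k : ℝ) - ℓ) ^ ℓ * 1 := by
        refine mul_le_mul_of_nonneg_left ?_ (by positivity)
        rw [← Real.exp_add, Real.exp_le_one_iff]
        linarith
    _ ≤ _ := by rwa [mul_one]

/-- The fraction of `k`-subsets of an `n`-set containing a fixed `ℓ`-subset, as a quotient of
falling factorials. -/
theorem choose_sub_div_choose_eq_descFactorial_div {ℓ k n : ℕ} (hlk : ℓ ≤ k) (hkn : k ≤ n) :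
    ((n - ℓ).choose (k - ℓ) : ℝ) / (n.choose k : ℝ) =
      (k.descFactorial ℓ : ℝ) / (n.descFactorial ℓ : ℝ) := by
  have hc : (n.choose k : ℝ) ≠ 0 := by exact_mod_cast (Nat.choose_pos hkn).ne'
  have hd : (n.descFactorial ℓ : ℝ) ≠ 0 := by
    exact_mod_cast (Nat.descFactorial_pos.mpr (hlk.trans hkn)).ne'
  rw [div_eq_div_iff hc hd]
  have h : (n.choose k * k.choose ℓ : ℝ) = n.choose ℓ * (n - ℓ).choose (k - ℓ) := by
    exact_mod_cast Nat.choose_mul hlk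
  rw [Nat.descFactorial_eq_factorial_mul_choose, Nat.descFactorial_eq_factorial_mul_choose]
  push_cast
  linear_combination -(ℓ.factorial : ℝ) * h

/-- **Fraction of marked states in the Johnson graph when `ℓ = O(√k)`.**
Let `ℓ, k, n` be natural numbers with `ℓ² ≤ k`, `2ℓ ≤ k`, `k ≤ n`, and `n ≥ 1`.
Then `C(n-ℓ, k-ℓ) / C(n, k) ≥ e⁻² · (k/n) ^ ℓ`, where the quotient and powers
are taken in the real numbers. -/
theorem johnson_marked_fraction_sqrt
    (ℓ k n : ℕ) (hl2 : ℓ ^ 2 ≤ k) (h2l : 2 * ℓ ≤ k) (hkn : k ≤ n) (hn : 1 ≤ n) :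
    Real.exp (-2) * ((k : ℝ) / (n : ℝ)) ^ ℓ ≤
      ((n - ℓ).choose (k - ℓ) : ℝ) / (n.choose k : ℝ) := by
  have hd : (0 : ℝ) < n.descFactorial ℓ := by
    exact_mod_cast Nat.descFactorial_pos.mpr (by omega : ℓ ≤ n)
  rw [choose_sub_div_choose_eq_descFactorial_div (by omega) hkn, div_pow, ← mul_div_assoc]
  exact div_le_div₀ (Nat.cast_nonneg _) (exp_neg_two_mul_pow_le_descFactorial hl2 h2l) hd
    (by exact_mod_cast Nat.descFactorial_le_pow n ℓ)
end

section
/- Let n and k be natural numbers with 1 ≤ k ≤ n−1, and let P be the real matrix indexed by the k-element subsets of {1, …, n} with entries P(A, B) = 1/(k(n−k)) when |A ∩ B| = k−1 and P(A, B) = 0 otherwise. Then for every real vector x indexed by the k-element subsets of {1, …, n} with Σ_A x(A) = 0, one has Σ_{A,B} x(A) P(A,B) x(B) ≤ (1 − 1/k − 1/(n−k)) · Σ_A x(A)². In other words, every eigenvalue of P on the orthogonal complement of the all-ones vector is at most 1 − 1/k − 1/(n−k), so the spectral gap of the symmetric walk on the Johnson graph J(n, k) is at least 1/k + 1/(n−k).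 -/
section SubsetOperators

variable {α : Type*} [Fintype α] [DecidableEq α]

/-- The down operator on functions on subsets: sum over all one-element extensions. -/
def downSum (f : Finset α → ℝ) (S : Finset α) : ℝ :=
  ∑ i ∈ Sᶜ, f (insert i S)

/-- The up operator on functions on subsets: sum over all one-element deletions. -/
def upSum (f : Finset α → ℝ) (S : Finset α) : ℝ :=
  ∑ j ∈ S, f (S.erase j)

/-- The adjacency operator of the Johnson graphs: sum over all one-element exchanges. -/
def swapSum (f : Finset α → ℝ) (S : Finset α) : ℝ :=
  ∑ j ∈ S, ∑ i ∈ Sᶜ, f (insert i (S.erase j))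

theorem sum_mul_upSum (f g : Finset α → ℝ) :
    ∑ S, f S * upSum g S = ∑ S, downSum f S * g S := by
  simp only [upSum, downSum, Finset.mul_sum, Finset.sum_mul]
  rw [Finset.sum_sigma', Finset.sum_sigma']
  refine Finset.sum_bij' (fun p _ => ⟨p.1.erase p.2, p.2⟩) (fun p _ => ⟨insert p.2 p.1, p.2⟩)
    ?_ ?_ ?_ ?_ ?_
  · simp
  · simp
  · rintro ⟨S, i⟩ h
    simp only [Finset.mem_sigma, Finset.mem_univ, true_and] at h
    simp [Finset.insert_erase h]
  · rintro ⟨S, i⟩ h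
    simp only [Finset.mem_sigma, Finset.mem_univ, true_and, Finset.mem_compl] at h
    simp [Finset.erase_insert h]
  · rintro ⟨S, i⟩ h
    simp only [Finset.mem_sigma, Finset.mem_univ, true_and] at h
    simp [Finset.insert_erase h]

theorem upSum_downSum (f : Finset α → ℝ) (S : Finset α) :
    upSum (downSum f) S = S.card * f S + swapSum f S := by
  have key : ∀ j ∈ S, downSum f (S.erase j) = f S + ∑ i ∈ Sᶜ, f (insert i (S.erase j)) := by
    intro j hj
    rw [downSum, Finset.compl_erase, Finset.sum_insert (by simpa using hj),
      Finset.insert_erase hj]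
  rw [upSum, Finset.sum_congr rfl key, Finset.sum_add_distrib, swapSum]
  simp

theorem downSum_upSum (f : Finset α → ℝ) (S : Finset α) :
    downSum (upSum f) S = ((Fintype.card α : ℝ) - S.card) * f S + swapSum f S := by
  have key : ∀ i ∈ Sᶜ, upSum f (insert i S) = f S + ∑ j ∈ S, f (insert i (S.erase j)) := by
    intro i hi
    rw [Finset.mem_compl] at hi
    rw [upSum, Finset.sum_insert hi, Finset.erase_insert hi]
    congr 1
    refine Finset.sum_congr rfl fun j hj => ?_
    rw [Finset.erase_insert_of_ne (by rintro rfl; exact hi hj)]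
  rw [downSum, Finset.sum_congr rfl key, Finset.sum_add_distrib, swapSum, Finset.sum_comm]
  simp [Finset.card_compl, Nat.cast_sub (Finset.card_le_univ S)]

theorem sum_upSum_sq {m : ℕ} {f : Finset α → ℝ} (hf : ∀ S, S.card ≠ m → f S = 0) :
    ∑ S, upSum f S ^ 2
      = ∑ S, downSum f S ^ 2 + ((Fintype.card α : ℝ) - 2 * m) * ∑ S, f S ^ 2 := by
  have hup : ∑ S, upSum f S ^ 2 = ∑ S, downSum (upSum f) S * f S := by
    rw [← sum_mul_upSum]
    simp only [sq]
  have hdown : ∑ S, downSum f S ^ 2 = ∑ S, f S * upSum (downSum f) S := by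
    rw [sum_mul_upSum]
    simp only [sq]
  rw [hup, hdown, Finset.mul_sum, ← Finset.sum_add_distrib]
  refine Finset.sum_congr rfl fun S _ => ?_
  rw [downSum_upSum, upSum_downSum]
  by_cases hS : S.card = m
  · rw [hS]; ring
  · rw [hf S hS]; ring

theorem downSum_eq_zero_of_card_ne {m : ℕ} {f : Finset α → ℝ}
    (hf : ∀ S, S.card ≠ m + 1 → f S = 0) (S : Finset α) (hS : S.card ≠ m) :
    downSum f S = 0 := by
  refine Finset.sum_eq_zero fun i hi => hf _ ?_
  rw [Finset.card_insert_of_notMem (by simpa using hi)]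
  omega

theorem sum_downSum {m : ℕ} {f : Finset α → ℝ} (hf : ∀ S, S.card ≠ m → f S = 0) :
    ∑ S, downSum f S = m * ∑ S, f S := by
  have h := sum_mul_upSum f (fun _ => 1)
  simp only [mul_one] at h
  rw [← h, Finset.mul_sum]
  refine Finset.sum_congr rfl fun S _ => ?_
  by_cases hS : S.card = m
  · simp [upSum, hS, mul_comm]
  · simp [hf S hS]

theorem sum_downSum_sq_le {m : ℕ} (hm : m + 1 ≤ Fintype.card α) {f : Finset α → ℝ}
    (hf : ∀ S, S.card ≠ m + 1 → f S = 0) (hsum : ∑ S, f S = 0) :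
    ∑ S, downSum f S ^ 2 ≤ m * ((Fintype.card α : ℝ) - (m + 1)) * ∑ S, f S ^ 2 := by
  induction m generalizing f with
  | zero =>
    have hD := downSum_eq_zero_of_card_ne hf
    have htot := sum_downSum hf
    rw [hsum, mul_zero, Finset.sum_eq_single ∅ (fun S _ hS => hD S (by simpa using hS))
      (by simp)] at htot
    have hzero : ∀ S, downSum f S = 0 := fun S => by
      by_cases hS : S = ∅
      · rw [hS, htot]
      · exact hD S (by simpa using hS)
    simp [hzero]
  | succ m ih =>
    have hD := downSum_eq_zero_of_card_ne hf
    have hih := ih (by omega) hD (by rw [sum_downSum hf, hsum, mul_zero])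
    have hup := sum_upSum_sq hD
    have hinner : ∑ S, f S * upSum (downSum f) S = ∑ S, downSum f S ^ 2 := by
      rw [sum_mul_upSum]
      simp only [sq]
    have hcs := Finset.sum_mul_sq_le_sq_mul_sq Finset.univ f (upSum (downSum f))
    rw [hinner] at hcs
    have hx : 0 ≤ ∑ S, f S ^ 2 := Finset.sum_nonneg fun S _ => sq_nonneg _
    have hy : 0 ≤ ∑ S, downSum f S ^ 2 := Finset.sum_nonneg fun S _ => sq_nonneg _
    have hm' : ((m : ℝ) + 1 + 1) ≤ Fintype.card α := by exact_mod_cast hm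
    push_cast at hup ⊢
    set X := ∑ S, f S ^ 2
    set Y := ∑ S, downSum f S ^ 2
    set c := ((m : ℝ) + 1) * ((Fintype.card α : ℝ) - (m + 1 + 1)) with hc
    have hc0 : 0 ≤ c := mul_nonneg (by positivity) (by linarith)
    have hU : ∑ S, upSum (downSum f) S ^ 2 ≤ c * Y := by
      rw [hup, hc]
      linarith
    have hYY : Y * Y ≤ (c * X) * Y := by
      have := mul_le_mul_of_nonneg_left hU hx
      linarith
    rcases hy.eq_or_lt with h0 | h0
    · rw [← h0]
      exact mul_nonneg hc0 hx
    · exact le_of_mul_le_mul_right hYY h0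

theorem sum_inter_card_eq_swapSum {m : ℕ} (f : Finset α → ℝ) {A : Finset α}
    (hA : A.card = m + 1) :
    ∑ B ∈ Finset.powersetCard (m + 1) Finset.univ with (A ∩ B).card = m, f B
      = swapSum f A := by
  rw [swapSum, ← Finset.sum_product']
  symm
  have hdiff : ∀ i j, i ∉ A → j ∈ A →
      A \ insert i (A.erase j) = {j} ∧ insert i (A.erase j) \ A = {i} := by
    intro i j hi hj
    constructor <;> ext a <;> simp <;> grind
  refine Finset.sum_bij (fun p _ => insert p.2 (A.erase p.1)) ?_ ?_ ?_ (fun _ _ => rfl)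
  · rintro ⟨j, i⟩ h
    simp only [Finset.mem_product, Finset.mem_compl] at h
    have hcard : (insert i (A.erase j)).card = m + 1 := by
      rw [Finset.card_insert_of_notMem (by simp [h.2]), Finset.card_erase_of_mem h.1, hA]
      rfl
    have hinter : A ∩ insert i (A.erase j) = A.erase j := by
      ext a; simp; grind
    simp [hcard, hinter, Finset.card_erase_of_mem h.1, hA]
  · rintro ⟨j, i⟩ h ⟨j', i'⟩ h' heq
    simp only [Finset.mem_product, Finset.mem_compl] at h h' heq
    have h1 := hdiff i j h.2 h.1
    have h2 := hdiff i' j' h'.2 h'.1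
    rw [heq, h2.1, h2.2, Finset.singleton_inj, Finset.singleton_inj] at h1
    rw [h1.1, h1.2]
  · intro B hB
    simp only [Finset.mem_filter, Finset.mem_powersetCard_univ] at hB
    have hAB := Finset.card_sdiff_add_card_inter A B
    have hBA := Finset.card_sdiff_add_card_inter B A
    rw [Finset.inter_comm] at hBA
    obtain ⟨j, hj⟩ := Finset.card_eq_one.mp (show (A \ B).card = 1 by omega)
    obtain ⟨i, hi⟩ := Finset.card_eq_one.mp (show (B \ A).card = 1 by omega)
    simp only [Finset.ext_iff, Finset.mem_sdiff, Finset.mem_singleton] at hi hj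
    refine ⟨(j, i), ?_, ?_⟩
    · simp only [Finset.mem_product, Finset.mem_compl]
      exact ⟨((hj j).2 rfl).1, ((hi i).2 rfl).2⟩
    · ext a
      simp only [Finset.mem_insert, Finset.mem_erase]
      grind

theorem sum_mul_swapSum_le {m : ℕ} (hm : m + 1 ≤ Fintype.card α) {f : Finset α → ℝ}
    (hf : ∀ S, S.card ≠ m + 1 → f S = 0) (hsum : ∑ S, f S = 0) :
    ∑ S, f S * swapSum f S
      ≤ (m * ((Fintype.card α : ℝ) - (m + 1)) - (m + 1)) * ∑ S, f S ^ 2 := by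
  have hle := sum_downSum_sq_le hm hf hsum
  have heq : ∑ S, downSum f S ^ 2 = (m + 1) * ∑ S, f S ^ 2 + ∑ S, f S * swapSum f S := by
    simp only [sq (downSum f _)]
    rw [← sum_mul_upSum, Finset.mul_sum, ← Finset.sum_add_distrib]
    refine Finset.sum_congr rfl fun S _ => ?_
    rw [upSum_downSum]
    by_cases hS : S.card = m + 1
    · rw [hS]; push_cast; ring
    · rw [hf S hS]; ring
  linarith

end SubsetOperators


/-- The transition matrix of the symmetric random walk on the Johnson graph
`J(n, k)`: `P A B = 1 / (k * (n - k))` when `|A ∩ B| = k - 1`, and `0`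
otherwise. -/
noncomputable def johnsonP (n k : ℕ) (A B : Finset (Fin n)) : ℝ :=
  if (A ∩ B).card = k - 1 then 1 / ((k * (n - k) : ℕ) : ℝ) else 0

/-- **Spectral gap of the symmetric walk on the Johnson graph `J(n, k)`.**
Let `1 ≤ k ≤ n - 1` and let `P` be the transition matrix of the symmetric
walk on `J(n, k)`.  For every real vector `x` indexed by the `k`-element
subsets of an `n`-element set with `∑_A x A = 0`, we have
`∑_{A,B} x A * P A B * x B ≤ (1 - 1/k - 1/(n-k)) * ∑_A (x A)²`; i.e. every
eigenvalue of `P` on the orthogonal complement of the all-ones vector is at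
most `1 - 1/k - 1/(n-k)`, so the spectral gap is at least `1/k + 1/(n-k)`. -/
theorem johnson_spectral_gap (n k : ℕ) (hk : 1 ≤ k) (hkn : k ≤ n - 1)
    (x : Finset (Fin n) → ℝ)
    (hx : ∑ A ∈ Finset.powersetCard k (Finset.univ : Finset (Fin n)), x A = 0) :
    ∑ A ∈ Finset.powersetCard k (Finset.univ : Finset (Fin n)),
      ∑ B ∈ Finset.powersetCard k (Finset.univ : Finset (Fin n)),
        x A * johnsonP n k A B * x B
      ≤ (1 - 1 / (k : ℝ) - 1 / ((n - k : ℕ) : ℝ)) *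
        ∑ A ∈ Finset.powersetCard k (Finset.univ : Finset (Fin n)), x A ^ 2 := by
  obtain ⟨m, rfl⟩ : ∃ m, k = m + 1 := ⟨k - 1, by omega⟩
  set f : Finset (Fin n) → ℝ := fun A => if A.card = m + 1 then x A else 0 with hf
  have hfx : ∀ A ∈ Finset.powersetCard (m + 1) (Finset.univ : Finset (Fin n)), f A = x A :=
    fun A hA => if_pos (Finset.mem_powersetCard_univ.mp hA)
  have hf0 : ∀ A, A.card ≠ m + 1 → f A = 0 := fun A hA => if_neg hA
  have hext : ∀ g : Finset (Fin n) → ℝ, (∀ A, A.card ≠ m + 1 → g A = 0) →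
      ∑ A ∈ Finset.powersetCard (m + 1) (Finset.univ : Finset (Fin n)), g A = ∑ A, g A :=
    fun g hg => Finset.sum_subset (Finset.subset_univ _)
      fun A _ hA => hg A (by simpa using hA)
  have hsum : ∑ A, f A = 0 := by
    rw [← hext f hf0, Finset.sum_congr rfl hfx, hx]
  have hsq : ∑ A ∈ Finset.powersetCard (m + 1) (Finset.univ : Finset (Fin n)), x A ^ 2
      = ∑ A, f A ^ 2 := by
    rw [← hext _ fun A hA => by rw [hf0 A hA]; simp]
    exact Finset.sum_congr rfl fun A hA => by rw [hfx A hA]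
  have hform : ∑ A ∈ Finset.powersetCard (m + 1) (Finset.univ : Finset (Fin n)),
      ∑ B ∈ Finset.powersetCard (m + 1) (Finset.univ : Finset (Fin n)),
        x A * johnsonP n (m + 1) A B * x B
      = 1 / (((m + 1) * (n - (m + 1)) : ℕ) : ℝ) * ∑ A, f A * swapSum f A := by
    rw [← hext _ fun A hA => by rw [hf0 A hA, zero_mul], Finset.mul_sum]
    refine Finset.sum_congr rfl fun A hA => ?_
    rw [← sum_inter_card_eq_swapSum f (Finset.mem_powersetCard_univ.mp hA), Finset.sum_filter,
      Finset.mul_sum, Finset.mul_sum, hfx A hA]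
    refine Finset.sum_congr rfl fun B hB => ?_
    rw [hfx B hB, johnsonP, Nat.add_sub_cancel]
    split_ifs <;> ring
  have hle := sum_mul_swapSum_le (by rw [Fintype.card_fin]; omega) hf0 hsum
  rw [Fintype.card_fin] at hle
  have hn : 0 < (n : ℝ) - (m + 1) := by
    rw [sub_pos]
    exact_mod_cast (show m + 1 < n by omega)
  rw [hform, hsq, Nat.cast_mul, Nat.cast_sub (by omega)]
  push_cast
  calc _ ≤ 1 / (((m : ℝ) + 1) * (n - (m + 1)))
        * ((m * ((n : ℝ) - (m + 1)) - (m + 1)) * ∑ A, f A ^ 2) := by gcongr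
    _ = _ := by
      have hm : (m : ℝ) + 1 ≠ 0 := by positivity
      have hn' := hn.ne'
      field_simp
      ring
end
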